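/- arXiv:2311.06540 — 2 statements merged into one kernel-verified Lean document; each statement's English description precedes it below -/
import Mathlib

section
/- Let M be a Lie algebra of maximal class over a field E and let C be a 2-step centraliser of M (i.e. C = C_j for some j ≥ 2). If t is the smallest integer such that C_t = C, then every interval of integers of length t (within the indices ≥ 2) contains at least one index j such that C_j = C. In particular, there are infinitely many indices j with C_j = C. -/
set_option synthInstance.maxHeartbeats 1000000
set_option maxHeartbeats 1000000

section Defs

variable (R : Type*) [Field R] {M : Type*} [LieRing M] [Module R M]

/-- The graded pieces of the Lie subalgebra generated in degree 1 by `L1`: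
`gradedPieces R L1 1 = L1` and `gradedPieces R L1 (i+1) = [gradedPieces R L1 i, L1]`. -/
def gradedPieces (L1 : Submodule R M) : ℕ → Submodule R M
  | 0 => ⊥
  | 1 => L1
  | (n + 2) => Submodule.span R
      {z | ∃ x ∈ gradedPieces L1 (n + 1), ∃ y ∈ L1, z = ⁅x, y⁆}

/-- Iterated bracketing with `L1`, starting from `X0`:
`bracketIter R L1 X0 (j+1) = [bracketIter R L1 X0 j, L1]`. -/
def bracketIter (L1 X0 : Submodule R M) : ℕ → Submodule R M
  | 0 => X0
  | (j + 1) => Submodule.span R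
      {z | ∃ x ∈ bracketIter L1 X0 j, ∃ y ∈ L1, z = ⁅x, y⁆}

/-- `gr` is the grading of a graded Lie algebra `⊕_{i ≥ 1} gr i`, generated by its
first homogeneous component. -/
structure IsGradedLie (gr : ℕ → Submodule R M) : Prop where
  bot : gr 0 = ⊥
  internal : DirectSum.IsInternal gr
  bracket_mem : ∀ i j, ∀ x ∈ gr i, ∀ y ∈ gr j, ⁅x, y⁆ ∈ gr (i + j)
  gen : ∀ i, 1 ≤ i → gr (i + 1) =
    Submodule.span R {z | ∃ x ∈ gr i, ∃ y ∈ gr 1, z = ⁅x, y⁆}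

/-- `J` is a graded ideal of the graded Lie algebra with grading `gr`, presented via its
homogeneous components `J i = J ∩ gr i`. -/
def IsGradedIdealFam (gr J : ℕ → Submodule R M) : Prop :=
  (∀ i, J i ≤ gr i) ∧ ∀ i j, ∀ z ∈ J i, ∀ x ∈ gr j, ⁅z, x⁆ ∈ J (i + j)

/-- The graded Lie algebra with grading `gr` is ideally `r`-constrained: every nonzero
graded ideal `J` satisfies `L^i ⊇ J ⊇ L^(i+r)` for some `i`. -/
def IdeallyConstrained (gr : ℕ → Submodule R M) (r : ℕ) : Prop :=
  ∀ J : ℕ → Submodule R M, IsGradedIdealFam R gr J → (∃ i, J i ≠ ⊥) →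
    ∃ i, (∀ j, j < i → J j = ⊥) ∧ ∀ j, i + r ≤ j → J j = gr j

/-- The graded Lie algebra with grading `gr` is just infinite: every nonzero graded ideal
has finite codimension. -/
def JustInfinite (gr : ℕ → Submodule R M) : Prop :=
  ∀ J : ℕ → Submodule R M, IsGradedIdealFam R gr J → (∃ i, J i ≠ ⊥) →
    FiniteDimensional R (↥(⨆ i, gr i) ⧸ ((⨆ i, J i).comap (⨆ i, gr i).subtype))

end Defs

section MaxClass

variable (E : Type*) [Field E] {M : Type*} [LieRing M] [LieAlgebra E M]

/-- `gr` is the grading of a Lie algebra of maximal class over `E`. -/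
structure IsMaxClass (gr : ℕ → Submodule E M) : Prop where
  graded : IsGradedLie E gr
  dim_one : Module.finrank E ↥(gr 1) = 2
  dim_ge_two : ∀ i, 2 ≤ i → Module.finrank E ↥(gr i) = 1

/-- The `i`-th two-step centraliser `C_i = C_{M_1}(M_i)`. -/
def twoStepCent (gr : ℕ → Submodule E M) (i : ℕ) : Submodule E M :=
  gr 1 ⊓ ⨅ m : ↥(gr i), LinearMap.ker (LieAlgebra.ad E M (m : M))

end MaxClass

/-- The set `E_s` of scalars stabilising a subset `s` of an `E`-vector space. -/
def scalarStab (E : Type*) [Field E] {M : Type*} [AddCommGroup M] [Module E M]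
    (s : Set M) : Set E := {α | ∀ v ∈ s, α • v ∈ s}


section TwoStepCentralisers

variable {E : Type*} [Field E] {M : Type*} [LieRing M] [LieAlgebra E M]
  {gr : ℕ → Submodule E M}

theorem mem_twoStepCent {i : ℕ} {y : M} :
    y ∈ twoStepCent E gr i ↔ y ∈ gr 1 ∧ ∀ z ∈ gr i, ⁅z, y⁆ = 0 := by
  simp [twoStepCent]

theorem iterate_ad_mem (h : IsGradedLie E gr) {i : ℕ} {y z : M} (hy : y ∈ gr 1) (hz : z ∈ gr i)
    (k : ℕ) : (LieAlgebra.ad E M y)^[k] z ∈ gr (i + k) := by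
  induction k with
  | zero => simpa using hz
  | succ k ih =>
    rw [Function.iterate_succ_apply', show i + (k + 1) = 1 + (i + k) by omega]
    exact h.bracket_mem _ _ _ hy _ ih

theorem iterate_ad_lie_of_lie_eq_zero {y w : M} (hw : ⁅y, w⁆ = 0) (x : M) (k : ℕ) :
    (LieAlgebra.ad E M y)^[k] ⁅w, x⁆ = ⁅w, (LieAlgebra.ad E M y)^[k] x⁆ := by
  induction k with
  | zero => rfl
  | succ k ih =>
    rw [Function.iterate_succ_apply', Function.iterate_succ_apply', ih, LieAlgebra.ad_apply,
      LieAlgebra.ad_apply, leibniz_lie, hw, zero_lie, zero_add]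

namespace IsMaxClass

theorem exists_ne_zero (hM : IsMaxClass E gr) {i : ℕ} (hi : 2 ≤ i) : ∃ z ∈ gr i, z ≠ 0 := by
  refine Submodule.exists_mem_ne_zero_of_ne_bot fun h => ?_
  have := hM.dim_ge_two i hi
  rw [h, finrank_bot] at this
  omega

/-- A nonzero element of `gr i` has the same centraliser in `gr 1` as all of `gr i`. -/
theorem mem_twoStepCent_of_lie_eq_zero (hM : IsMaxClass E gr) {i : ℕ} (hi : 2 ≤ i) {y z : M}
    (hy : y ∈ gr 1) (hz : z ∈ gr i) (hz0 : z ≠ 0) (h : ⁅z, y⁆ = 0) :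
    y ∈ twoStepCent E gr i := by
  refine mem_twoStepCent.2 ⟨hy, fun w hw => ?_⟩
  obtain ⟨c, hc⟩ := exists_smul_eq_of_finrank_eq_one (hM.dim_ge_two i hi)
    (x := (⟨z, hz⟩ : gr i)) (by simpa using hz0) ⟨w, hw⟩
  have hc' : c • z = w := congrArg Subtype.val hc
  rw [← hc', smul_lie, h, smul_zero]

theorem twoStepCent_lt (hM : IsMaxClass E gr) {i : ℕ} (hi : 2 ≤ i) :
    twoStepCent E gr i < gr 1 := by
  refine lt_of_le_of_ne inf_le_left fun h => ?_
  obtain ⟨z, hz, hz0⟩ := hM.exists_ne_zero (i := i + 1) (by omega)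
  rw [hM.graded.gen i (by omega)] at hz
  refine hz0 ((Submodule.mem_bot E).1 (Submodule.span_le.2 ?_ hz))
  rintro _ ⟨u, hu, y, hy, rfl⟩
  exact (mem_twoStepCent.1 (h ▸ hy)).2 u hu

theorem exists_mem_twoStepCent_ne_zero (hM : IsMaxClass E gr) {i : ℕ} (hi : 2 ≤ i) :
    ∃ y ∈ twoStepCent E gr i, y ≠ 0 := by
  obtain ⟨z, hz, hz0⟩ := hM.exists_ne_zero hi
  let f : gr 1 →ₗ[E] gr (i + 1) :=
    (LieAlgebra.ad E M z).restrict fun y hy => hM.graded.bracket_mem _ _ _ hz _ hy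
  have : FiniteDimensional E (gr 1) :=
    Module.finite_of_finrank_pos (by rw [hM.dim_one]; norm_num)
  have : FiniteDimensional E (gr (i + 1)) :=
    Module.finite_of_finrank_pos (by rw [hM.dim_ge_two _ (by omega)]; norm_num)
  obtain ⟨y, hy, hy0⟩ := Submodule.exists_mem_ne_zero_of_ne_bot
    (f.ker_ne_bot_of_finrank_lt (by rw [hM.dim_one, hM.dim_ge_two _ (by omega)]; norm_num))
  exact ⟨y, hM.mem_twoStepCent_of_lie_eq_zero hi y.2 hz hz0 (congrArg Subtype.val hy),
    by simpa using hy0⟩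

theorem twoStepCent_eq_span (hM : IsMaxClass E gr) {i : ℕ} (hi : 2 ≤ i) {y : M}
    (hy : y ∈ twoStepCent E gr i) (hy0 : y ≠ 0) : twoStepCent E gr i = E ∙ y := by
  have : FiniteDimensional E (gr 1) :=
    Module.finite_of_finrank_pos (by rw [hM.dim_one]; norm_num)
  have hlt := Submodule.finrank_lt_finrank_of_lt (hM.twoStepCent_lt hi)
  have : FiniteDimensional E (twoStepCent E gr i) :=
    Submodule.finiteDimensional_of_le (hM.twoStepCent_lt hi).le
  rw [hM.dim_one] at hlt
  refine (Submodule.eq_of_le_of_finrank_le ?_ ?_).symm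
  · rwa [Submodule.span_singleton_le_iff_mem]
  · rw [finrank_span_singleton hy0]
    omega

/-- If `C_t = C_j`, then the same centraliser occurs again among the `t` indices following `j`. -/
theorem exists_twoStepCent_eq (hM : IsMaxClass E gr) {t j : ℕ} (ht : 2 ≤ t) (hj : 2 ≤ j)
    (htj : twoStepCent E gr j = twoStepCent E gr t) :
    ∃ k, j < k ∧ k ≤ j + t ∧ twoStepCent E gr k = twoStepCent E gr t := by
  by_contra! hne
  obtain ⟨y, hyt, hy0⟩ := hM.exists_mem_twoStepCent_ne_zero ht
  have hy := (mem_twoStepCent.1 hyt).1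
  obtain ⟨w, hw, hw0⟩ := hM.exists_ne_zero hj
  have hyw : ⁅y, w⁆ = 0 := by
    rw [← lie_skew, (mem_twoStepCent.1 (htj ▸ hyt)).2 w hw, neg_zero]
  obtain ⟨x, hx, hwx⟩ : ∃ x ∈ gr 1, ⁅w, x⁆ ≠ 0 := by
    by_contra! h
    exact (hM.twoStepCent_lt hj).not_ge
      fun x hx => hM.mem_twoStepCent_of_lie_eq_zero hj hx hw hw0 (h x hx)
  have hmem := iterate_ad_mem hM.graded hy (hM.graded.bracket_mem _ _ _ hw _ hx)
  have hnz : ∀ k ≤ t, (LieAlgebra.ad E M y)^[k] ⁅w, x⁆ ≠ 0 := by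
    intro k hk
    induction k with
    | zero => exact hwx
    | succ k ih =>
      intro h0
      rw [Function.iterate_succ_apply', LieAlgebra.ad_apply, ← lie_skew, neg_eq_zero] at h0
      have hyk := hM.mem_twoStepCent_of_lie_eq_zero (by omega) hy (hmem k) (ih (by omega)) h0
      refine hne (j + 1 + k) (by omega) (by omega) ?_
      rw [hM.twoStepCent_eq_span (by omega) hyk hy0, hM.twoStepCent_eq_span ht hyt hy0]
  refine hnz t le_rfl ?_
  obtain ⟨s, rfl⟩ : ∃ s, t = 1 + s := ⟨t - 1, by omega⟩
  rw [iterate_ad_lie_of_lie_eq_zero hyw, Nat.add_comm, Function.iterate_succ_apply',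
    LieAlgebra.ad_apply, ← lie_skew y,
    (mem_twoStepCent.1 hyt).2 _ (iterate_ad_mem hM.graded hy hx s), neg_zero, lie_zero]

end IsMaxClass

end TwoStepCentralisers

theorem specialisation (E : Type*) [Field E] (M : Type*) [LieRing M] [LieAlgebra E M]
    (Mgr : ℕ → Submodule E M) (hM : IsMaxClass E Mgr)
    (C : Submodule E M) (hC : ∃ j, 2 ≤ j ∧ twoStepCent E Mgr j = C)
    (t : ℕ) (ht2 : 2 ≤ t) (htC : twoStepCent E Mgr t = C)
    (htmin : ∀ s, 2 ≤ s → twoStepCent E Mgr s = C → t ≤ s) :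
    (∀ a, 2 ≤ a → ∃ j, a ≤ j ∧ j < a + t ∧ twoStepCent E Mgr j = C) ∧
    (∀ n, ∃ j, n ≤ j ∧ 2 ≤ j ∧ twoStepCent E Mgr j = C) := by
  subst htC
  have window : ∀ a, 2 ≤ a →
      ∃ j, a ≤ j ∧ j < a + t ∧ twoStepCent E Mgr j = twoStepCent E Mgr t := by
    intro a ha
    induction a, ha using Nat.le_induction with
    | base => exact ⟨t, ht2, by omega, rfl⟩
    | succ a ha ih =>
      obtain ⟨j, haj, hja, hj⟩ := ih
      rcases haj.eq_or_lt with rfl | hlt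
      · obtain ⟨k, hk, hkt, hkC⟩ := hM.exists_twoStepCent_eq ht2 ha hj
        exact ⟨k, hk, by omega, hkC⟩
      · exact ⟨j, hlt, by omega, hj⟩
  refine ⟨window, fun n => ?_⟩
  obtain ⟨j, hj, -, hjC⟩ := window (n + 2) (by omega)
  exact ⟨j, by omega, by omega, hjC⟩
end

section
/- Let F be a field, α an algebraic element of degree d ≥ 2 over F, and E := F(α). Let M be a Lie E-algebra of maximal class all of whose 2-step centralisers coincide, with common 2-step centraliser C (the metabelian Lie algebra of maximal class). Choose a nonzero y ∈ C and a nonzero x ∈ M_1 \ C, and let L_1 be the F-subspace of M_1 spanned by x, αx and y. Then the Lie F-subalgebra L of M generated by L_1 is ideally d-constrained but not ideally (d−1)-constrained. In particular, for every positive integer r there exists an ideally r-constrained graded Lie algebra which is not ideally (r−1)-constrained. -/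
set_option synthInstance.maxHeartbeats 1000000
set_option maxHeartbeats 1000000

/-- A graded Lie algebra which is ideally `r`-constrained but not ideally
`(r-1)`-constrained. -/
structure ConstrainedExample (r : ℕ) : Type 1 where
  R : Type
  [fieldR : Field R]
  L : Type
  [lieRingL : LieRing L]
  [lieAlgL : LieAlgebra R L]
  grading : ℕ → Submodule R L
  graded : IsGradedLie R grading
  nonzero : ∀ i, 1 ≤ i → grading i ≠ ⊥
  constrained : IdeallyConstrained R grading r
  not_constrained : ¬ IdeallyConstrained R grading (r - 1)


section PowerSpan

variable (F : Type*) {E : Type*} [Field F] [Field E] [Algebra F E] (α : E)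

/-- The `F`-span of `1, α, …, α ^ (n - 1)`. -/
def powerSpan (n : ℕ) : Submodule F E :=
  Submodule.span F ((α ^ ·) '' Set.Iio n)

variable {F α}

lemma pow_mem_powerSpan {k n : ℕ} (h : k < n) : α ^ k ∈ powerSpan F α n :=
  Submodule.subset_span ⟨k, h, rfl⟩

lemma powerSpan_mono {m n : ℕ} (h : m ≤ n) : powerSpan F α m ≤ powerSpan F α n :=
  Submodule.span_mono (Set.image_mono (Set.Iio_subset_Iio h))

lemma mul_self_mem_powerSpan {n : ℕ} {c : E} (hc : c ∈ powerSpan F α n) :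
    c * α ∈ powerSpan F α (n + 1) := by
  induction hc using Submodule.span_induction with
  | mem u hu =>
    obtain ⟨k, hk, rfl⟩ := hu
    simp only [← pow_succ]
    exact pow_mem_powerSpan (by simpa using hk)
  | zero => simp
  | add u v _ _ hu hv => rw [add_mul]; exact add_mem hu hv
  | smul a u _ hu => rw [smul_mul_assoc]; exact Submodule.smul_mem _ _ hu

lemma mul_linear_mem_powerSpan {n : ℕ} {c : E} (hc : c ∈ powerSpan F α n) (a b : F) :
    c * (a • 1 + b • α) ∈ powerSpan F α (n + 1) := by
  rw [mul_add, mul_smul_comm, mul_smul_comm, mul_one]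
  exact add_mem (Submodule.smul_mem _ _ (powerSpan_mono n.le_succ hc))
    (Submodule.smul_mem _ _ (mul_self_mem_powerSpan hc))

lemma powerSpan_eq_top (hα : IsIntegral F α) (hgen : IntermediateField.adjoin F {α} = ⊤)
    {n : ℕ} (h : (minpoly F α).natDegree ≤ n) : powerSpan F α n = ⊤ := by
  classical
  refine eq_top_iff.mpr (le_trans ?_ (powerSpan_mono h))
  have h1 := Submodule.span_range_natDegree_eq_adjoin (minpoly.monic hα) (minpoly.aeval F α)
  have h2 : Algebra.adjoin F {α} = ⊤ := by
    rw [← IntermediateField.adjoin_simple_toSubalgebra_of_isAlgebraic hα.isAlgebraic, hgen,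
      IntermediateField.top_toSubalgebra]
  rw [h2, Algebra.top_toSubmodule] at h1
  rw [← h1]
  simp [powerSpan]

lemma powerSpan_ne_top {n : ℕ} (h : n < (minpoly F α).natDegree) :
    powerSpan F α n ≠ ⊤ := by
  intro htop
  have hmem : α ^ n ∈ powerSpan F α n := htop ▸ Submodule.mem_top
  have hli := linearIndependent_pow (K := F) α
  refine hli.notMem_span_image (s := {i | (i : ℕ) < n}) (x := ⟨n, h⟩) (by simp) ?_
  refine Submodule.span_mono ?_ hmem
  rintro _ ⟨k, hk, rfl⟩
  exact ⟨⟨k, lt_trans hk h⟩, hk, rfl⟩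

end PowerSpan

/-- The iterated brackets `y, ⁅y, x⁆, ⁅⁅y, x⁆, x⁆, …`. -/
def bracketChain {M : Type*} [LieRing M] (x y : M) : ℕ → M
  | 0 => y
  | n + 1 => ⁅bracketChain x y n, x⁆

lemma bracketChain_lie_bracketChain {M : Type*} [LieRing M] {x y : M}
    (hy : ∀ n, ⁅bracketChain x y n, y⁆ = 0) (m n : ℕ) :
    ⁅bracketChain x y m, bracketChain x y n⁆ = 0 := by
  induction n generalizing m with
  | zero => exact hy m
  | succ n ih =>
    have h : ⁅bracketChain x y n, ⁅bracketChain x y m, x⁆⁆ = 0 := by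
      rw [← lie_skew, ← bracketChain, ih (m + 1), neg_zero]
    rw [bracketChain, leibniz_lie, ih m, h, zero_lie, add_zero]

section Chain

variable {F E M : Type*} [Field F] [Field E] [Algebra F E] {α : E}
  [LieRing M] [LieAlgebra F M] [LieAlgebra E M] [IsScalarTower F E M] {x y : M}

variable (F α x y) in
/-- The `F`-subspace `powerSpan F α m • bracketChain x y n`. -/
def chainPiece (m n : ℕ) : Submodule F M :=
  (powerSpan F α m).map ((LinearMap.toSpanSingleton E M (bracketChain x y n)).restrictScalars F)

lemma mem_chainPiece {m n : ℕ} {z : M} :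
    z ∈ chainPiece F α x y m n ↔ ∃ c ∈ powerSpan F α m, c • bracketChain x y n = z := by
  simp [chainPiece]

lemma chainPiece_mono {m m' : ℕ} (h : m ≤ m') (n : ℕ) :
    chainPiece F α x y m n ≤ chainPiece F α x y m' n :=
  Submodule.map_mono (powerSpan_mono h)

lemma mem_span_generators {z : M} :
    z ∈ Submodule.span F {x, α • x, y} ↔
      ∃ a b c : F, (a • 1 + b • α : E) • x + (c • 1 : E) • y = z := by
  simp only [Submodule.mem_span_triple, add_smul, smul_assoc, one_smul]

lemma generator_lie_generator (s t : E) (s' t' : E) :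
    ⁅s • x + t • y, s' • x + t' • y⁆ = (t * s' - t' * s) • bracketChain x y 1 := by
  have h : ⁅x, y⁆ = - ⁅y, x⁆ := (lie_skew x y).symm
  simp only [bracketChain, add_lie, lie_add, smul_lie, lie_smul, lie_self, h]
  module

lemma chain_lie_smul (n : ℕ) (c s : E) :
    ⁅c • bracketChain x y n, s • x⁆ = (c * s) • bracketChain x y (n + 1) := by
  rw [bracketChain, smul_lie, lie_smul, smul_smul]

lemma chain_lie_left (n : ℕ) (c : E) :
    ⁅c • bracketChain x y n, x⁆ = c • bracketChain x y (n + 1) := by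
  rw [bracketChain, smul_lie]

lemma chain_lie_generator (hy : ∀ n, ⁅bracketChain x y n, y⁆ = 0) (n : ℕ) (c s t : E) :
    ⁅c • bracketChain x y n, s • x + t • y⁆ = (c * s) • bracketChain x y (n + 1) := by
  rw [lie_add, chain_lie_smul, smul_lie, lie_smul, hy, smul_zero, smul_zero, add_zero]

lemma chainPiece_lie_mem (hy : ∀ n, ⁅bracketChain x y n, y⁆ = 0) {m n : ℕ} {z w : M}
    (hz : z ∈ chainPiece F α x y m n) (hw : w ∈ Submodule.span F {x, α • x, y}) :
    ⁅z, w⁆ ∈ chainPiece F α x y (m + 1) (n + 1) := by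
  obtain ⟨c, hc, rfl⟩ := mem_chainPiece.mp hz
  obtain ⟨a, b, t, rfl⟩ := mem_span_generators.mp hw
  rw [chain_lie_generator hy]
  exact mem_chainPiece.mpr ⟨_, mul_linear_mem_powerSpan hc a b, rfl⟩

lemma chainPiece_le_of_forall {m n : ℕ} {N : Submodule F M}
    (h : ∀ k < m, α ^ k • bracketChain x y n ∈ N) : chainPiece F α x y m n ≤ N := by
  rw [chainPiece, powerSpan, Submodule.map_span, Submodule.span_le]
  rintro _ ⟨_, ⟨k, hk, rfl⟩, rfl⟩
  exact h k hk

lemma gradedPieces_add_two (hy : ∀ n, ⁅bracketChain x y n, y⁆ = 0) (n : ℕ) :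
    gradedPieces F (Submodule.span F {x, α • x, y}) (n + 2) =
      chainPiece F α x y (n + 2) (n + 1) := by
  have hx : x ∈ Submodule.span F {x, α • x, y} := Submodule.subset_span (by simp)
  have hαx : α • x ∈ Submodule.span F {x, α • x, y} := Submodule.subset_span (by simp)
  have hyL : y ∈ Submodule.span F {x, α • x, y} := Submodule.subset_span (by simp)
  induction n with
  | zero =>
    rw [gradedPieces]
    apply le_antisymm
    · rw [Submodule.span_le]
      rintro _ ⟨z, hz, w, hw, rfl⟩
      rw [gradedPieces] at hz
      obtain ⟨a, b, t, rfl⟩ := mem_span_generators.mp hz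
      obtain ⟨a', b', t', rfl⟩ := mem_span_generators.mp hw
      rw [generator_lie_generator]
      refine mem_chainPiece.mpr ⟨_, ?_, rfl⟩
      have h1 : ∀ t : F, (t • 1 : E) ∈ powerSpan F α 1 := fun t =>
        Submodule.smul_mem _ _ (by simpa using pow_mem_powerSpan (F := F) (α := α) one_pos)
      exact sub_mem (mul_linear_mem_powerSpan (h1 t) a' b') (mul_linear_mem_powerSpan (h1 t') a b)
    · refine chainPiece_le_of_forall fun k hk => Submodule.subset_span ⟨y, hyL, α ^ k • x, ?_, ?_⟩
      · interval_cases k <;> simpa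
      · simp [bracketChain]
  | succ n ih =>
    rw [gradedPieces]
    apply le_antisymm
    · rw [Submodule.span_le]
      rintro _ ⟨z, hz, w, hw, rfl⟩
      rw [ih] at hz
      exact chainPiece_lie_mem hy hz hw
    · refine chainPiece_le_of_forall fun k hk => Submodule.subset_span ?_
      rw [ih]
      rcases k with _ | k
      · exact ⟨_, mem_chainPiece.mpr ⟨_, pow_mem_powerSpan (Nat.succ_pos _), rfl⟩, x, hx,
          by rw [chain_lie_left, pow_zero]⟩
      · exact ⟨_, mem_chainPiece.mpr ⟨_, pow_mem_powerSpan (Nat.succ_lt_succ_iff.mp hk), rfl⟩,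
          α • x, hαx, by rw [chain_lie_smul, pow_succ]⟩

lemma generator_coeffs_eq_zero (hne : ∀ n, bracketChain x y n ≠ 0) {s t : E}
    (h : s • x + t • y = 0) : s = 0 ∧ t = 0 := by
  have h1 := generator_lie_generator (x := x) (y := y) s t 0 1
  rw [h, zero_lie, eq_comm, smul_eq_zero_iff_left (hne 1)] at h1
  have hs : s = 0 := by simpa using h1
  rw [hs, zero_smul, zero_add] at h
  exact ⟨hs, (smul_eq_zero_iff_left (hne 0)).mp h⟩

lemma mul_smul_chain_mem {F E M : Type*} [Field F] [Field E] {α : E} [LieRing M] [LieAlgebra F M]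
    [LieAlgebra E M] {x y : M} {J : ℕ → Submodule F M}
    (hJ : IsGradedIdealFam F (gradedPieces F (Submodule.span F {x, α • x, y})) J)
    {n : ℕ} {c : E} (hc : c • bracketChain x y (n + 1) ∈ J (n + 2)) (m k : ℕ) (hk : k < m + 1) :
    (c * α ^ k) • bracketChain x y (n + 1 + m) ∈ J (n + 2 + m) := by
  have hx : x ∈ Submodule.span F {x, α • x, y} := Submodule.subset_span (by simp)
  have hαx : α • x ∈ Submodule.span F {x, α • x, y} := Submodule.subset_span (by simp)
  induction m generalizing k with
  | zero =>
    obtain rfl : k = 0 := by omega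
    simpa using hc
  | succ m ih =>
    rcases k with _ | k
    · simpa only [chain_lie_left, ← add_assoc] using hJ.2 _ 1 _ (ih 0 (by omega)) x hx
    · simpa only [chain_lie_smul, ← add_assoc, pow_succ, mul_assoc] using
        hJ.2 _ 1 _ (ih k (by omega)) (α • x) hαx

lemma eq_gradedPieces_of_powerSpan_eq_top (hy : ∀ n, ⁅bracketChain x y n, y⁆ = 0)
    {J : ℕ → Submodule F M}
    (hJ : IsGradedIdealFam F (gradedPieces F (Submodule.span F {x, α • x, y})) J)
    {n : ℕ} {c : E} (hc0 : c ≠ 0) (hc : c • bracketChain x y (n + 1) ∈ J (n + 2)) {m : ℕ}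
    (hm : powerSpan F α (m + 1) = ⊤) :
    J (n + 2 + m) = gradedPieces F (Submodule.span F {x, α • x, y}) (n + 2 + m) := by
  refine le_antisymm (hJ.1 _) ?_
  rw [show n + 2 + m = n + m + 2 by omega, gradedPieces_add_two hy]
  intro z hz
  obtain ⟨s, -, rfl⟩ := mem_chainPiece.mp hz
  have hs : c⁻¹ * s ∈ powerSpan F α (m + 1) := hm ▸ Submodule.mem_top
  have key : powerSpan F α (m + 1) ≤ (J (n + m + 2)).comap
      (((LinearMap.toSpanSingleton E M (bracketChain x y (n + m + 1))).restrictScalars F) ∘ₗ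
        LinearMap.mulLeft F c) := by
    rw [powerSpan, Submodule.span_le]
    rintro _ ⟨k, hk, rfl⟩
    have := mul_smul_chain_mem hJ hc m k hk
    rw [show n + 2 + m = n + m + 2 by omega, show n + 1 + m = n + m + 1 by omega] at this
    exact this
  simpa [mul_inv_cancel_left₀ hc0] using key hs

lemma ideallyConstrained_of_chain (hy : ∀ n, ⁅bracketChain x y n, y⁆ = 0)
    (hα : IsIntegral F α) (hgen : IntermediateField.adjoin F {α} = ⊤) :
    IdeallyConstrained F (gradedPieces F (Submodule.span F {x, α • x, y}))
      (minpoly F α).natDegree := by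
  classical
  intro J hJ hex
  have hd : 0 < (minpoly F α).natDegree := minpoly.natDegree_pos hα
  have full : ∀ {n : ℕ} {c : E}, c ≠ 0 → c • bracketChain x y (n + 1) ∈ J (n + 2) → ∀ j,
      n + 1 + (minpoly F α).natDegree ≤ j →
        J j = gradedPieces F (Submodule.span F {x, α • x, y}) j := by
    intro n c hc0 hc j hj
    obtain ⟨m, rfl⟩ := Nat.exists_eq_add_of_le (show n + 2 ≤ j by omega)
    exact eq_gradedPieces_of_powerSpan_eq_top hy hJ hc0 hc (powerSpan_eq_top hα hgen (by omega))
  refine ⟨Nat.find hex, fun j hj => not_not.mp (Nat.find_min hex hj), fun j hj => ?_⟩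
  obtain ⟨z, hz, hz0⟩ := Submodule.exists_mem_ne_zero_of_ne_bot (Nat.find_spec hex)
  generalize Nat.find hex = i at hz hj
  match i with
  | 0 => exact absurd (by simpa [gradedPieces] using hJ.1 0 hz) hz0
  | 1 =>
    have hx : x ∈ Submodule.span F {x, α • x, y} := Submodule.subset_span (by simp)
    have hyL : y ∈ Submodule.span F {x, α • x, y} := Submodule.subset_span (by simp)
    obtain ⟨a, b, t, rfl⟩ := mem_span_generators.mp (hJ.1 1 hz)
    have h1 := hJ.2 1 1 _ hz x hx
    have h2 := hJ.2 1 1 _ hz y hyL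
    have e1 := generator_lie_generator (x := x) (y := y) (a • 1 + b • α) (t • 1) 1 0
    have e2 := generator_lie_generator (x := x) (y := y) (a • 1 + b • α) (t • 1) 0 1
    simp only [zero_smul, one_smul, zero_add, add_zero] at e1 e2
    rw [e1] at h1
    rw [e2] at h2
    by_cases ht : (t • 1 : E) = 0
    · refine full (n := 0) (fun hs => hz0 ?_) h2 j (by omega)
      have : (a • 1 + b • α : E) = 0 := by
        rwa [mul_zero, one_mul, zero_sub, neg_eq_zero] at hs
      rw [this, ht, zero_smul, zero_smul, add_zero]
    · exact full (n := 0) (by simpa using ht) h1 j (by omega)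
  | n + 2 =>
    have hz' := hJ.1 _ hz
    rw [gradedPieces_add_two hy] at hz'
    obtain ⟨c, -, rfl⟩ := mem_chainPiece.mp hz'
    exact full (fun h => hz0 (by rw [h, zero_smul])) hz j (by omega)

variable (F α x y) in
/-- The homogeneous components of the graded ideal generated by `x`. -/
def idealOfGenerator : ℕ → Submodule F M
  | 0 => ⊥
  | 1 => Submodule.span F {x}
  | n + 2 => chainPiece F α x y (n + 1) (n + 1)

lemma isGradedIdealFam_idealOfGenerator (hy : ∀ n, ⁅bracketChain x y n, y⁆ = 0) :
    IsGradedIdealFam F (gradedPieces F (Submodule.span F {x, α • x, y}))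
      (idealOfGenerator F α x y) := by
  constructor
  · intro i
    match i with
    | 0 => exact bot_le
    | 1 => exact Submodule.span_mono (by simp)
    | n + 2 =>
      rw [gradedPieces_add_two hy]
      exact chainPiece_mono (Nat.le_succ _) _
  · intro i j z hz w hw
    match i, j with
    | 0, j =>
      obtain rfl : z = 0 := hz
      simp
    | i, 0 =>
      obtain rfl : w = 0 := by simpa [gradedPieces] using hw
      simp
    | 1, 1 =>
      obtain ⟨a, rfl⟩ := Submodule.mem_span_singleton.mp hz
      obtain ⟨a', b', t, rfl⟩ := mem_span_generators.mp hw
      have h := generator_lie_generator (x := x) (y := y) 1 0 (a' • 1 + b' • α) (t • 1)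
      simp only [zero_smul, one_smul, add_zero] at h
      rw [smul_lie, h]
      refine Submodule.smul_mem _ _ (mem_chainPiece.mpr ⟨_, ?_, rfl⟩)
      have : (-t) • α ^ 0 ∈ powerSpan F α (0 + 1) :=
        Submodule.smul_mem _ _ (pow_mem_powerSpan one_pos)
      simpa using this
    | 1, n + 2 =>
      obtain ⟨a, rfl⟩ := Submodule.mem_span_singleton.mp hz
      rw [gradedPieces_add_two hy] at hw
      obtain ⟨c, hc, rfl⟩ := mem_chainPiece.mp hw
      rw [show 1 + (n + 2) = n + 1 + 2 by omega, smul_lie, ← lie_skew, smul_lie, ← bracketChain]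
      exact Submodule.smul_mem _ _ (neg_mem (mem_chainPiece.mpr ⟨c, hc, rfl⟩))
    | m + 2, 1 => exact chainPiece_lie_mem hy hz hw
    | m + 2, n + 2 =>
      rw [gradedPieces_add_two hy] at hw
      obtain ⟨c, hc, rfl⟩ := mem_chainPiece.mp hw
      obtain ⟨c', hc', rfl⟩ := mem_chainPiece.mp hz
      rw [smul_lie, lie_smul, bracketChain_lie_bracketChain hy]
      simp

lemma not_ideallyConstrained_of_chain (hy : ∀ n, ⁅bracketChain x y n, y⁆ = 0)
    (hne : ∀ n, bracketChain x y n ≠ 0)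
    (hα : IsIntegral F α) (hgen : IntermediateField.adjoin F {α} = ⊤) :
    ¬ IdeallyConstrained F (gradedPieces F (Submodule.span F {x, α • x, y}))
      ((minpoly F α).natDegree - 1) := by
  intro H
  have hd : 0 < (minpoly F α).natDegree := minpoly.natDegree_pos hα
  have hx0 : x ≠ 0 := fun h => hne 1 (by simp [bracketChain, h])
  have hx1 : idealOfGenerator F α x y 1 ≠ ⊥ := by simpa [idealOfGenerator] using hx0
  obtain ⟨i, hi, htop⟩ := H _ (isGradedIdealFam_idealOfGenerator hy) ⟨1, hx1⟩
  have hi1 : i ≤ 1 := not_lt.mp fun h => hx1 (hi 1 h)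
  have key := htop (minpoly F α).natDegree (by omega)
  rcases hdeg : (minpoly F α).natDegree with _ | _ | n
  · omega
  · rw [hdeg] at key
    have hyJ : y ∈ idealOfGenerator F α x y 1 := key ▸ Submodule.subset_span (by simp)
    obtain ⟨a, ha⟩ := Submodule.mem_span_singleton.mp hyJ
    have : (-(a • 1) : E) • x + (1 : E) • y = 0 := by
      rw [← ha, neg_smul, smul_assoc, one_smul, one_smul, neg_add_cancel]
    exact one_ne_zero (generator_coeffs_eq_zero hne this).2
  · rw [hdeg, gradedPieces_add_two hy] at key
    have hinj : Function.Injective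
        ((LinearMap.toSpanSingleton E M (bracketChain x y (n + 1))).restrictScalars F) :=
      smul_left_injective E (hne _)
    have h := Submodule.map_injective_of_injective hinj key
    rw [powerSpan_eq_top hα hgen hdeg.le] at h
    exact powerSpan_ne_top (by omega) h

end Chain

section MaximalClass

variable {E M : Type*} [Field E] [LieRing M] [LieAlgebra E M] {gr : ℕ → Submodule E M} {x y : M}

lemma lie_eq_zero_of_mem_twoStepCent {i : ℕ} (hy : y ∈ twoStepCent E gr i) {m : M}
    (hm : m ∈ gr i) : ⁅m, y⁆ = 0 := by
  have h := (Submodule.mem_iInf _).mp hy.2 ⟨m, hm⟩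
  simpa using h

lemma bracketChain_mem (hgr : IsGradedLie E gr) (hx : x ∈ gr 1) (hy : y ∈ gr 1) (n : ℕ) :
    bracketChain x y n ∈ gr (n + 1) := by
  induction n with
  | zero => exact hy
  | succ n ih => exact hgr.bracket_mem _ 1 _ ih _ hx

lemma bracketChain_lie_eq_zero (hgr : IsGradedLie E gr)
    (hcent : ∀ i, 2 ≤ i → twoStepCent E gr i = twoStepCent E gr 2)
    (hy : y ∈ twoStepCent E gr 2) (hx : x ∈ gr 1) (n : ℕ) : ⁅bracketChain x y n, y⁆ = 0 := by
  rcases n with _ | n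
  · exact lie_self y
  · exact lie_eq_zero_of_mem_twoStepCent (hcent (n + 2) (by omega) ▸ hy)
      (bracketChain_mem hgr hx hy.1 (n + 1))

lemma IsMaxClass.gr_one_le_span (hM : IsMaxClass E gr) (hy : y ∈ twoStepCent E gr 2) (hy0 : y ≠ 0)
    (hx1 : x ∈ gr 1) (hx : x ∉ twoStepCent E gr 2) : gr 1 ≤ Submodule.span E {x, y} := by
  have hli : LinearIndependent E ![x, y] := by
    refine LinearIndependent.pair_iff.mpr fun s t h => ?_
    have hs : s = 0 := by
      by_contra hs
      apply hx
      have : x = (-(s⁻¹ * t)) • y := by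
        rw [neg_smul, mul_smul, ← smul_neg, ← eq_neg_of_add_eq_zero_left h, inv_smul_smul₀ hs]
      rw [this]
      exact Submodule.smul_mem _ _ hy
    rw [hs, zero_smul, zero_add] at h
    exact ⟨hs, (smul_eq_zero_iff_left hy0).mp h⟩
  have : FiniteDimensional E (gr 1) := Module.finite_of_finrank_pos (by rw [hM.dim_one]; norm_num)
  have hle : Submodule.span E {x, y} ≤ gr 1 := by
    rw [Submodule.span_le]
    rintro _ (rfl | rfl)
    exacts [hx1, hy.1]
  refine (Submodule.eq_of_le_of_finrank_eq hle ?_).ge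
  have := finrank_span_eq_card hli
  rw [Matrix.range_cons_cons_empty] at this
  rw [this, hM.dim_one, Fintype.card_fin]

lemma IsMaxClass.gr_le_span_bracketChain (hM : IsMaxClass E gr)
    (hcent : ∀ i, 2 ≤ i → twoStepCent E gr i = twoStepCent E gr 2)
    (hy : y ∈ twoStepCent E gr 2) (hy0 : y ≠ 0)
    (hx1 : x ∈ gr 1) (hx : x ∉ twoStepCent E gr 2) (n : ℕ) :
    gr (n + 2) ≤ Submodule.span E {bracketChain x y (n + 1)} := by
  have h1 : ∀ z ∈ gr 1, ∃ s t : E, s • x + t • y = z := fun z hz =>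
    Submodule.mem_span_pair.mp (hM.gr_one_le_span hy hy0 hx1 hx hz)
  induction n with
  | zero =>
    rw [hM.graded.gen 1 le_rfl, Submodule.span_le]
    rintro _ ⟨z, hz, w, hw, rfl⟩
    obtain ⟨s, t, rfl⟩ := h1 w hw
    obtain ⟨s', t', rfl⟩ := h1 z hz
    rw [generator_lie_generator]
    exact Submodule.smul_mem _ _ (Submodule.mem_span_singleton_self _)
  | succ n ih =>
    rw [hM.graded.gen (n + 2) (by omega), Submodule.span_le]
    rintro _ ⟨z, hz, w, hw, rfl⟩
    obtain ⟨s, t, rfl⟩ := h1 w hw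
    obtain ⟨c, rfl⟩ := Submodule.mem_span_singleton.mp (ih hz)
    rw [chain_lie_generator (bracketChain_lie_eq_zero hM.graded hcent hy hx1)]
    exact Submodule.smul_mem _ _ (Submodule.mem_span_singleton_self _)

lemma IsMaxClass.bracketChain_ne_zero (hM : IsMaxClass E gr)
    (hcent : ∀ i, 2 ≤ i → twoStepCent E gr i = twoStepCent E gr 2)
    (hy : y ∈ twoStepCent E gr 2) (hy0 : y ≠ 0)
    (hx1 : x ∈ gr 1) (hx : x ∉ twoStepCent E gr 2) (n : ℕ) : bracketChain x y n ≠ 0 := by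
  rcases n with _ | n
  · exact hy0
  · intro h
    have hle := hM.gr_le_span_bracketChain hcent hy hy0 hx1 hx n
    rw [h, Submodule.span_zero_singleton, le_bot_iff] at hle
    have := hM.dim_ge_two (n + 2) (by omega)
    rw [hle, finrank_bot] at this
    exact zero_ne_one this

end MaximalClass

section GradedPieces

variable {F M : Type*} [Field F] [LieRing M] [LieAlgebra F M] {L1 : Submodule F M}

lemma gradedPieces_lie_mem_succ {i : ℕ} {z w : M} (hz : z ∈ gradedPieces F L1 i) (hw : w ∈ L1) :
    ⁅z, w⁆ ∈ gradedPieces F L1 (i + 1) := by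
  rcases i with _ | i
  · obtain rfl : z = 0 := by simpa [gradedPieces] using hz
    simp
  · exact Submodule.subset_span ⟨z, hz, w, hw, rfl⟩

lemma gradedPieces_lie_mem (i j : ℕ) (z : M) (hz : z ∈ gradedPieces F L1 i) (w : M)
    (hw : w ∈ gradedPieces F L1 j) : ⁅z, w⁆ ∈ gradedPieces F L1 (i + j) := by
  induction j generalizing i z w with
  | zero =>
    obtain rfl : w = 0 := by simpa [gradedPieces] using hw
    simp
  | succ j ih =>
    rcases j with _ | j
    · exact gradedPieces_lie_mem_succ hz hw
    · rw [gradedPieces] at hw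
      induction hw using Submodule.span_induction with
      | mem u hu =>
        obtain ⟨a, ha, b, hb, rfl⟩ := hu
        rw [leibniz_lie]
        refine add_mem (gradedPieces_lie_mem_succ (ih i z hz a ha) hb) ?_
        rw [← lie_skew]
        have := ih (i + 1) _ (gradedPieces_lie_mem_succ hz hb) a ha
        rw [show i + 1 + (j + 1) = i + (j + 1 + 1) by omega] at this
        exact neg_mem this
      | zero => simp
      | add u v _ _ hu hv => rw [lie_add]; exact add_mem hu hv
      | smul a u _ hu => rw [lie_smul]; exact Submodule.smul_mem _ _ hu

variable (F L1) in
/-- The Lie subalgebra `⨆ i, gradedPieces F L1 i` generated by `L1`. -/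
def generatedSubalgebra : LieSubalgebra F M where
  toSubmodule := ⨆ i, gradedPieces F L1 i
  lie_mem' := by
    intro z w hz hw
    change z ∈ ⨆ i, gradedPieces F L1 i at hz
    change w ∈ ⨆ i, gradedPieces F L1 i at hw
    change ⁅z, w⁆ ∈ ⨆ i, gradedPieces F L1 i
    induction hz using Submodule.iSup_induction' with
    | mem i z hz =>
      induction hw using Submodule.iSup_induction' with
      | mem j w hw => exact Submodule.mem_iSup_of_mem _ (gradedPieces_lie_mem i j z hz w hw)
      | zero => simp
      | add u v _ _ hu hv => rw [lie_add]; exact add_mem hu hv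
    | zero => simp
    | add u v _ _ hu hv => rw [add_lie]; exact add_mem hu hv

lemma gradedPieces_le_generatedSubalgebra (i : ℕ) :
    gradedPieces F L1 i ≤ (generatedSubalgebra F L1).toSubmodule :=
  le_iSup (gradedPieces F L1) i

variable (F L1) in
/-- The grading `gradedPieces F L1`, seen inside the Lie subalgebra generated by `L1`. -/
def generatedGrading (i : ℕ) : Submodule F (generatedSubalgebra F L1) :=
  (gradedPieces F L1 i).comap (generatedSubalgebra F L1).toSubmodule.subtype

lemma mem_generatedGrading {i : ℕ} {z : generatedSubalgebra F L1} :
    z ∈ generatedGrading F L1 i ↔ (z : M) ∈ gradedPieces F L1 i :=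
  Iff.rfl

lemma map_generatedGrading (i : ℕ) :
    (generatedGrading F L1 i).map (generatedSubalgebra F L1).toSubmodule.subtype =
      gradedPieces F L1 i := by
  rw [generatedGrading, Submodule.map_comap_subtype,
    inf_eq_right.mpr (gradedPieces_le_generatedSubalgebra i)]

lemma map_subtype_injective (N : Submodule F M) :
    Function.Injective (Submodule.map N.subtype) :=
  Submodule.map_injective_of_injective N.injective_subtype

lemma isInternal_generatedGrading (hind : iSupIndep (gradedPieces F L1)) :
    DirectSum.IsInternal (generatedGrading F L1) := by
  refine DirectSum.isInternal_submodule_of_iSupIndep_of_iSup_eq_top ?_ ?_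
  · intro i
    rw [disjoint_iff]
    apply map_subtype_injective
    rw [Submodule.map_bot, Submodule.map_inf _ (Submodule.injective_subtype _)]
    simp only [Submodule.map_iSup, map_generatedGrading]
    exact (hind i).eq_bot
  · apply map_subtype_injective
    simp only [Submodule.map_iSup, map_generatedGrading]
    rw [Submodule.map_top, Submodule.range_subtype]
    rfl

lemma isGradedLie_generatedGrading (hind : iSupIndep (gradedPieces F L1)) :
    IsGradedLie F (generatedGrading F L1) where
  bot := by
    apply map_subtype_injective
    rw [map_generatedGrading, Submodule.map_bot, gradedPieces]
  internal := isInternal_generatedGrading hind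
  bracket_mem i j z hz w hw := mem_generatedGrading.mpr <|
    gradedPieces_lie_mem i j (z : M) (mem_generatedGrading.mp hz) (w : M) (mem_generatedGrading.mp hw)
  gen i hi := by
    obtain ⟨i, rfl⟩ := Nat.exists_eq_add_of_le' hi
    apply map_subtype_injective
    rw [map_generatedGrading, Submodule.map_span, gradedPieces]
    congr 1
    ext z
    constructor
    · rintro ⟨a, ha, b, hb, rfl⟩
      exact ⟨⁅⟨a, gradedPieces_le_generatedSubalgebra _ ha⟩,
        ⟨b, gradedPieces_le_generatedSubalgebra 1 hb⟩⁆, ⟨_, ha, _, hb, rfl⟩, rfl⟩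
    · rintro ⟨_, ⟨a, ha, b, hb, rfl⟩, rfl⟩
      exact ⟨a, ha, b, hb, rfl⟩

lemma ideallyConstrained_generatedGrading_iff (r : ℕ) :
    IdeallyConstrained F (generatedGrading F L1) r ↔
      IdeallyConstrained F (gradedPieces F L1) r := by
  have hbot : ∀ N : Submodule F (generatedSubalgebra F L1),
      N.map (generatedSubalgebra F L1).toSubmodule.subtype = ⊥ ↔ N = ⊥ := fun N => by
    rw [← (map_subtype_injective (generatedSubalgebra F L1).toSubmodule).eq_iff, Submodule.map_bot]
  have hgr : ∀ (N : Submodule F (generatedSubalgebra F L1)) (j : ℕ),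
      N.map (generatedSubalgebra F L1).toSubmodule.subtype = gradedPieces F L1 j ↔
        N = generatedGrading F L1 j := fun N j => by
    rw [← map_generatedGrading]
    exact (map_subtype_injective _).eq_iff
  constructor
  · intro H J hJ hne
    have hmap : ∀ i, ((J i).comap (generatedSubalgebra F L1).toSubmodule.subtype).map
        (generatedSubalgebra F L1).toSubmodule.subtype = J i := fun i => by
      rw [Submodule.map_comap_subtype,
        inf_eq_right.mpr ((hJ.1 i).trans (gradedPieces_le_generatedSubalgebra i))]
    have := H (fun i => (J i).comap (generatedSubalgebra F L1).toSubmodule.subtype)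
      ⟨fun i => Submodule.comap_mono (hJ.1 i), fun i j z hz w hw => hJ.2 i j z hz w hw⟩
    simpa only [← hbot, ← hgr, hmap, ne_eq, hne, forall_const] using this (by
      simpa only [ne_eq, ← hbot, hmap] using hne)
  · intro H J hJ hne
    have := H (fun i => (J i).map (generatedSubalgebra F L1).toSubmodule.subtype) ⟨fun i => ?_, ?_⟩
    · simpa only [hbot, hgr, ne_eq] using this (by simpa only [ne_eq, hbot] using hne)
    · rw [← map_generatedGrading]
      exact Submodule.map_mono (hJ.1 i)
    · rintro i j _ ⟨z, hz, rfl⟩ w hw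
      let z' : generatedSubalgebra F L1 := z
      let w' : generatedSubalgebra F L1 := ⟨w, gradedPieces_le_generatedSubalgebra j hw⟩
      exact ⟨⁅z', w'⁆, hJ.2 i j z hz _ hw, rfl⟩

end GradedPieces

noncomputable section

/-- The metabelian Lie algebra of maximal class over `E`, on a basis `x, e₁, e₂, …` indexed by `ℕ`,
with `⁅eᵢ, x⁆ = eᵢ₊₁` and `⁅eᵢ, eⱼ⁆ = 0`. -/
def MetabelianLie (E : Type*) [Field E] : Type _ := ℕ →₀ E

namespace MetabelianLie

variable {E : Type*} [Field E]

instance : AddCommGroup (MetabelianLie E) := inferInstanceAs (AddCommGroup (ℕ →₀ E))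

instance {F : Type*} [Field F] [Algebra F E] : Module F (MetabelianLie E) :=
  inferInstanceAs (Module F (ℕ →₀ E))

instance {F : Type*} [Field F] [Algebra F E] : IsScalarTower F E (MetabelianLie E) :=
  inferInstanceAs (IsScalarTower F E (ℕ →₀ E))

/-- The coefficient of `x`. -/
def coeffZero : MetabelianLie E →ₗ[E] E := Finsupp.lapply 0

/-- The linear map sending each basis vector to the next one. -/
def shift : MetabelianLie E →ₗ[E] MetabelianLie E := Finsupp.lmapDomain E E Nat.succ

/-- The basis vectors. -/
def basisVec (n : ℕ) : MetabelianLie E := Finsupp.single n 1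

lemma coeffZero_shift (f : MetabelianLie E) : coeffZero (shift f) = 0 :=
  Finsupp.mapDomain_of_notMem_range _ _ (by simp)

lemma shift_basisVec (n : ℕ) : shift (basisVec n : MetabelianLie E) = basisVec (n + 1) :=
  Finsupp.mapDomain_single

lemma coeffZero_basisVec_zero : coeffZero (basisVec 0 : MetabelianLie E) = 1 :=
  Finsupp.single_eq_same

lemma coeffZero_basisVec_succ (n : ℕ) : coeffZero (basisVec (n + 1) : MetabelianLie E) = 0 :=
  Finsupp.single_eq_of_ne (by simp)

instance : Bracket (MetabelianLie E) (MetabelianLie E) where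
  bracket f g := shift (coeffZero g • f - coeffZero f • g)

lemma lie_def (f g : MetabelianLie E) : ⁅f, g⁆ = shift (coeffZero g • f - coeffZero f • g) := rfl

instance : LieRing (MetabelianLie E) where
  add_lie f g h := by simp only [lie_def, map_add, map_sub, map_smul]; module
  lie_add f g h := by simp only [lie_def, map_add, map_sub, map_smul]; module
  lie_self f := by simp only [lie_def, sub_self, map_zero]
  leibniz_lie f g h := by
    simp only [lie_def, map_sub, map_smul, coeffZero_shift]; module

instance : LieAlgebra E (MetabelianLie E) where
  lie_smul t f g := by simp only [lie_def, map_sub, map_smul, smul_eq_mul]; module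

instance {F : Type*} [Field F] [Algebra F E] : LieAlgebra F (MetabelianLie E) where
  lie_smul t f g := by
    rw [← one_smul E g, ← smul_assoc, lie_smul, smul_assoc, one_smul, one_smul]

lemma bracketChain_basisVec (n : ℕ) :
    bracketChain (basisVec 0) (basisVec 1) n = (basisVec (n + 1) : MetabelianLie E) := by
  induction n with
  | zero => rfl
  | succ n ih =>
    rw [bracketChain, ih, lie_def, coeffZero_basisVec_zero, coeffZero_basisVec_succ, one_smul,
      zero_smul, sub_zero, shift_basisVec]

lemma bracketChain_lie_basisVec (n : ℕ) :
    ⁅bracketChain (basisVec 0 : MetabelianLie E) (basisVec 1) n,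
      (basisVec 1 : MetabelianLie E)⁆ = 0 := by
  rw [bracketChain_basisVec, lie_def, coeffZero_basisVec_succ 0, coeffZero_basisVec_succ n,
    zero_smul, zero_smul, sub_zero, map_zero]

lemma bracketChain_basisVec_ne_zero (n : ℕ) :
    bracketChain (basisVec 0) (basisVec 1) n ≠ (0 : MetabelianLie E) := by
  rw [bracketChain_basisVec]
  exact Finsupp.single_ne_zero.mpr one_ne_zero

/-- The set of indices of the basis vectors of degree `i`. -/
def degreeSupport : ℕ → Set ℕ
  | 0 => ∅
  | 1 => {0, 1}
  | n + 2 => {n + 2}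

lemma degreeSupport_subset (i : ℕ) : degreeSupport i ⊆ {k | max k 1 = i} := by
  match i with
  | 0 => exact Set.empty_subset _
  | 1 => rintro k (rfl | rfl) <;> simp
  | n + 2 => rintro k rfl; simp

/-- The vectors whose coefficients vanish outside the basis vectors of degree `i`. -/
def degreePiece (F E : Type*) [Field F] [Field E] [Algebra F E] (i : ℕ) :
    Submodule F (MetabelianLie E) :=
  Finsupp.supported E F (degreeSupport i)

lemma iSupIndep_degreePiece (F : Type*) [Field F] [Algebra F E] :
    iSupIndep (degreePiece F E) := by
  intro i
  refine (Finsupp.disjoint_supported_supported (M := E) (R := F)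
    (disjoint_compl_right (a := degreeSupport i))).mono_right (iSup₂_le fun j hji => ?_)
  refine Finsupp.supported_mono fun k hk hk' => hji ?_
  exact (degreeSupport_subset j hk).symm.trans (degreeSupport_subset i hk')

lemma smul_basisVec_mem_degreePiece (F : Type*) [Field F] [Algebra F E] (c : E) {n i : ℕ}
    (hn : n ∈ degreeSupport i) : c • (basisVec n : MetabelianLie E) ∈ degreePiece F E i :=
  (Finsupp.supported E E (degreeSupport i)).smul_mem c (Finsupp.single_mem_supported E 1 hn)

lemma iSupIndep_gradedPieces {F : Type*} [Field F] [Algebra F E] (α : E) :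
    iSupIndep (gradedPieces F (Submodule.span F
      {basisVec 0, α • basisVec 0, (basisVec 1 : MetabelianLie E)})) := by
  refine (iSupIndep_degreePiece F).mono fun i => ?_
  match i with
  | 0 => exact bot_le
  | 1 =>
    intro z hz
    obtain ⟨a, b, c, rfl⟩ := mem_span_generators.mp hz
    exact add_mem (smul_basisVec_mem_degreePiece F _ (Or.inl rfl))
      (smul_basisVec_mem_degreePiece F _ (Or.inr rfl))
  | n + 2 =>
    rw [gradedPieces_add_two bracketChain_lie_basisVec]
    intro z hz
    obtain ⟨c, -, rfl⟩ := mem_chainPiece.mp hz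
    rw [bracketChain_basisVec]
    exact smul_basisVec_mem_degreePiece F _ rfl

end MetabelianLie

end

lemma generatedGrading_ne_bot {F E M : Type*} [Field F] [Field E] {α : E}
    [LieRing M] [LieAlgebra F M] [LieAlgebra E M] {x y : M}
    (hne : ∀ n, bracketChain x y n ≠ 0) (i : ℕ)
    (hi : 1 ≤ i) : generatedGrading F (Submodule.span F {x, α • x, y}) i ≠ ⊥ := by
  obtain ⟨n, rfl⟩ := Nat.exists_eq_add_of_le' hi
  have hmem : bracketChain x y n ∈ gradedPieces F (Submodule.span F {x, α • x, y}) (n + 1) := by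
    induction n with
    | zero => exact Submodule.subset_span (by simp [bracketChain])
    | succ n ih => exact gradedPieces_lie_mem_succ (ih (by omega)) (Submodule.subset_span (by simp))
  intro h
  rw [← map_generatedGrading, h, Submodule.map_bot] at hmem
  exact hne n hmem

open MetabelianLie in
lemma nonempty_constrainedExample {F E : Type} [Field F] [Field E] [Algebra F E] {α : E}
    (hα : IsIntegral F α) (hgen : IntermediateField.adjoin F {α} = ⊤) :
    Nonempty (ConstrainedExample (minpoly F α).natDegree) :=
  ⟨{ R := F
     L := generatedSubalgebra F
       (Submodule.span F {basisVec 0, α • basisVec 0, (basisVec 1 : MetabelianLie E)})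
     grading := generatedGrading F _
     graded := isGradedLie_generatedGrading (iSupIndep_gradedPieces α)
     nonzero := generatedGrading_ne_bot bracketChain_basisVec_ne_zero
     constrained := (ideallyConstrained_generatedGrading_iff _).mpr
       (ideallyConstrained_of_chain bracketChain_lie_basisVec hα hgen)
     not_constrained := fun h => not_ideallyConstrained_of_chain bracketChain_lie_basisVec
       bracketChain_basisVec_ne_zero hα hgen ((ideallyConstrained_generatedGrading_iff _).mp h) }⟩

theorem rconstrained_example (F E : Type*) [Field F] [Field E] [Algebra F E]
    (α : E) (hα : IsIntegral F α) (d : ℕ) (hd : 2 ≤ d)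
    (hdeg : (minpoly F α).natDegree = d)
    (hgen : IntermediateField.adjoin F {α} = ⊤)
    (M : Type*) [LieRing M] [LieAlgebra E M] [Module F M] [IsScalarTower F E M]
    (Mgr : ℕ → Submodule E M) (hM : IsMaxClass E Mgr)
    (hmeta : ∀ i, 2 ≤ i → twoStepCent E Mgr i = twoStepCent E Mgr 2)
    (y : M) (hy : y ∈ twoStepCent E Mgr 2) (hy0 : y ≠ 0)
    (x : M) (hx1 : x ∈ Mgr 1) (hx : x ∉ twoStepCent E Mgr 2) (hx0 : x ≠ 0) :
    (IdeallyConstrained F (gradedPieces F (Submodule.span F {x, α • x, y})) d ∧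
      ¬ IdeallyConstrained F (gradedPieces F (Submodule.span F {x, α • x, y})) (d - 1)) ∧
    (∀ r : ℕ, 1 ≤ r → Nonempty (ConstrainedExample r)) := by
  constructor
  · let _ : LieAlgebra F M :=
      { lie_smul := fun t m n => by
          rw [← one_smul E n, ← smul_assoc, lie_smul, smul_assoc, one_smul, one_smul] }
    have hcomm := bracketChain_lie_eq_zero hM.graded hmeta hy hx1
    have hne := hM.bracketChain_ne_zero hmeta hy hy0 hx1 hx
    rw [← hdeg]
    exact ⟨ideallyConstrained_of_chain hcomm hα hgen,
      not_ideallyConstrained_of_chain hcomm hne hα hgen⟩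
  · intro r hr
    have hr0 : r ≠ 0 := by omega
    obtain ⟨β, hβ⟩ := Field.exists_primitive_element_of_finite_top (ZMod 2) (GaloisField 2 r)
    have hdegβ := (Field.primitive_element_iff_minpoly_natDegree_eq (ZMod 2) β).mp hβ
    rw [GaloisField.finrank 2 hr0] at hdegβ
    exact hdegβ ▸ nonempty_constrainedExample (IsIntegral.of_finite (ZMod 2) β) hβ
end
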